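/- arXiv:2103.05631 — 2 statements merged into one kernel-verified Lean document; each statement's English description precedes it below -/
import Mathlib

section
/- Let d ≥ 2, r ≤ d^k, and M_1,...,M_k ∈ F^{d×d}. Then R^{rc}(⊗_{i=1}^k M_i, (2d−2)r) ≤ (max over X ∈ F^{d×k} of R^{rc}(G_{d,k}(X), r))^{2d−2}. -/
/-- Row-column rigidity: the least `t` such that there is `Z` with
`rank (A - Z) ≤ r` and at most `t` nonzero entries in every row and column of `Z`. -/
noncomputable def rcRigid {F : Type*} [Field F] {α : Type*} [Fintype α] [DecidableEq α]
    (A : Matrix α α F) (r : ℕ) : ℕ :=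
  sInf {t | ∃ Z : Matrix α α F, (A - Z).rank ≤ r ∧
    (∀ i, Nat.card {j // Z i j ≠ 0} ≤ t) ∧ (∀ j, Nat.card {i // Z i j ≠ 0} ≤ t)}

/-- The V-matrix `G_d(x)`: first `d−1` columns are the standard basis vectors
`e_1, …, e_{d−1}`, and the last column is `x`. -/
def Gmat {F : Type*} [Field F] (d : ℕ) (x : Fin d → F) : Matrix (Fin d) (Fin d) F :=
  Matrix.of fun i j => if (j : ℕ) = d - 1 then x i else if i = j then (1 : F) else 0

/-- `G_{d,k}(X) = ⊗_{i=1}^k G_d(X_i)` for the columns `X_i` of `X`. -/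
def GmatK {F : Type*} [Field F] (d k : ℕ) (X : Fin k → Fin d → F) :
    Matrix (Fin k → Fin d) (Fin k → Fin d) F :=
  Matrix.of fun x y => ∏ i, Gmat d (X i) (x i) (y i)

/-- Elementary column-type matrix: the identity with column `p` replaced by `x`. -/
def Emat {F : Type*} [Field F] {d : ℕ} (p : Fin d) (x : Fin d → F) : Matrix (Fin d) (Fin d) F :=
  Matrix.of fun i j => if j = p then x i else if i = j then (1 : F) else 0

/-- Products of `n` column-type matrices and a permutation matrix. -/
def Fac {F : Type*} [Field F] {d : ℕ} : ℕ → Matrix (Fin d) (Fin d) F → Prop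
  | 0, A => ∃ σ : Equiv.Perm (Fin d), A = Matrix.of fun i j => if σ i = j then (1 : F) else 0
  | n + 1, A => ∃ (p : Fin d) (x : Fin d → F) (B : Matrix (Fin d) (Fin d) F),
      Fac n B ∧ A = Emat p x * B

lemma Emat_mul {F : Type*} [Field F] {d : ℕ} (p : Fin d) (x : Fin d → F)
    (B : Matrix (Fin d) (Fin d) F) (i l : Fin d) :
    (Emat p x * B) i l = (if i = p then 0 else B i l) + x i * B p l := by
  have h : ∀ j, Emat p x i j * B j l
      = (if j = i then (if i = p then 0 else B i l) else 0) + (if j = p then x i * B p l else 0) := by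
    intro j
    simp only [Emat, Matrix.of_apply]
    by_cases hj : j = p
    · subst hj
      by_cases hi : j = i <;> simp [hi]
    · by_cases hi : j = i
      · subst hi; simp [hj]
      · simp [hj, hi, Ne.symm hi]
  rw [Matrix.mul_apply, Finset.sum_congr rfl (fun j _ => h j), Finset.sum_add_distrib]
  simp

lemma fac_step {F : Type*} [Field F] {d : ℕ} (X : Matrix (Fin d) (Fin d) F) (p j : Fin d)
    (h : X p j ≠ 0 ∨ ∀ l, X p l = 0) :
    X = Emat p (fun i => X i j) * (Matrix.of fun i l =>
      if l = j then (if i = p then (1 : F) else 0)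
      else if i = p then X p l / X p j else X i l - X i j * (X p l / X p j)) := by
  ext i l
  rw [Emat_mul]
  simp only [Matrix.of_apply]
  by_cases hl : l = j
  · subst hl; by_cases hi : i = p <;> simp [hi]
  · rcases h with h | h
    · by_cases hi : i = p
      · subst hi; simp [hl]; field_simp
      · simp [hl, hi]
    · by_cases hi : i = p
      · subst hi; simp [hl, h]
      · simp [hl, hi, h]

lemma fac_all {F : Type*} [Field F] {d : ℕ} (hd : 0 < d) (n : ℕ) :
    ∀ (S : Finset (Fin d)) (σ : Equiv.Perm (Fin d)) (X : Matrix (Fin d) (Fin d) F),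
      (Sᶜ).card ≤ n → (∀ q ∈ S, ∀ i, X i (σ q) = if i = q then 1 else 0) → Fac n X := by
  induction n with
  | zero =>
    intro S σ X hS hX
    have hS' : S = Finset.univ := by simpa using hS
    subst hS'
    refine ⟨σ, ?_⟩
    ext i j
    have := hX (σ.symm j) (Finset.mem_univ _) i
    simp only [Equiv.apply_symm_apply] at this
    rw [this]
    simp [Equiv.eq_symm_apply]
  | succ n ih =>
    intro S σ X hS hX
    by_cases hu : S = Finset.univ
    · refine ⟨⟨0, hd⟩, fun i => if i = ⟨0, hd⟩ then 1 else 0, X, ih S σ X (by simp [hu]) hX, ?_⟩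
      ext i l
      rw [Emat_mul]
      by_cases hi : i = ⟨0, hd⟩ <;> simp [hi]
    · -- find pivot
      have key : ∃ p j, p ∉ S ∧ σ.symm j ∉ S ∧ (X p j ≠ 0 ∨ ∀ l, X p l = 0) := by
        by_cases hp : ∃ p j, p ∉ S ∧ X p j ≠ 0
        · obtain ⟨p, j, hp, hj⟩ := hp
          refine ⟨p, j, hp, ?_, Or.inl hj⟩
          intro hs
          have := hX _ hs p
          rw [Equiv.apply_symm_apply, if_neg] at this
          · exact hj this
          · rintro rfl; exact hp hs
        · push Not at hp
          obtain ⟨p, hpS⟩ : ∃ p, p ∉ S := by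
            by_contra! hc
            exact hu (Finset.eq_univ_iff_forall.2 hc)
          exact ⟨p, σ p, hpS, by simpa using hpS, Or.inr fun l => hp p l hpS⟩
      obtain ⟨p, j, hp, hj, h⟩ := key
      refine ⟨p, _, _, ?_, fac_step X p j h⟩
      refine ih (insert p S) ((Equiv.swap p (σ.symm j)).trans σ) _ ?_ ?_
      · have h1 : (insert p S).card = S.card + 1 := Finset.card_insert_of_notMem hp
        rw [Finset.card_compl] at hS ⊢
        omega
      · intro q hq i
        rcases Finset.mem_insert.1 hq with rfl | hq
        · simp
        · have hqp : q ≠ p := by intro hc; exact hp (hc ▸ hq)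
          have hqj : q ≠ σ.symm j := by rintro rfl; exact hj hq
          have e : ((Equiv.swap p (σ.symm j)).trans σ) q = σ q := by
            simp [Equiv.swap_apply_of_ne_of_ne hqp hqj]
          have hne : σ q ≠ j := by
            rintro rfl; simp at hqj
          rw [e]
          simp only [Matrix.of_apply, if_neg hne]
          rw [hX q hq p, if_neg hqp.symm, hX q hq i]
          by_cases hi : i = p
          · subst hi; simp [hqp.symm]
          · simp [hi]

/-- `A` is within rank `r` of a matrix with at most `t` nonzeros per row and column. -/
def Rig {F : Type*} [Field F] {α : Type*} [Fintype α] [DecidableEq α]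
    (A : Matrix α α F) (r t : ℕ) : Prop :=
  ∃ Z : Matrix α α F, (A - Z).rank ≤ r ∧
    (∀ i, Nat.card {j // Z i j ≠ 0} ≤ t) ∧ (∀ j, Nat.card {i // Z i j ≠ 0} ≤ t)

lemma rig_of_le {F : Type*} [Field F] {α : Type*} [Fintype α] [DecidableEq α]
    (A : Matrix α α F) (r t : ℕ) (h : rcRigid A r ≤ t) : Rig A r t := by
  have hne : {t | Rig A r t}.Nonempty := by
    refine ⟨Nat.card α, A, by simp, fun i => ?_, fun j => ?_⟩ <;>
    exact Nat.card_le_card_of_injective _ Subtype.val_injective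
  obtain ⟨Z, h1, h2, h3⟩ := Nat.sInf_mem hne
  exact ⟨Z, h1, fun i => (h2 i).trans h, fun i => (h3 i).trans h⟩

lemma card_mul_le {F : Type*} [Field F] {α : Type*} [Fintype α] [DecidableEq α]
    (Z W : Matrix α α F) (s t : ℕ) (hZ : ∀ i, Nat.card {j // Z i j ≠ 0} ≤ s)
    (hW : ∀ i, Nat.card {j // W i j ≠ 0} ≤ t) (i : α) :
    Nat.card {j // (Z * W) i j ≠ 0} ≤ s * t := by
  classical
  have conv : ∀ (Y : Matrix α α F) i, Nat.card {j // Y i j ≠ 0}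
      = (Finset.univ.filter fun j => Y i j ≠ 0).card := by
    intro Y i
    rw [Nat.card_eq_fintype_card, Fintype.card_subtype]
  rw [conv]
  have hsub : (Finset.univ.filter fun j => (Z * W) i j ≠ 0) ⊆
      (Finset.univ.filter fun j => Z i j ≠ 0).biUnion
        (fun m => Finset.univ.filter fun j => W m j ≠ 0) := by
    intro j hj
    simp only [Finset.mem_filter, Finset.mem_univ, true_and, Finset.mem_biUnion] at hj ⊢
    rw [Matrix.mul_apply] at hj
    obtain ⟨m, -, hm⟩ := Finset.exists_ne_zero_of_sum_ne_zero hj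
    exact ⟨m, left_ne_zero_of_mul hm, right_ne_zero_of_mul hm⟩
  refine (Finset.card_le_card hsub).trans ?_
  refine (Finset.card_biUnion_le_card_mul _ _ t ?_).trans ?_
  · intro m _
    rw [← conv]; exact hW m
  · rw [← conv]; exact Nat.mul_le_mul_right _ (hZ i)

lemma rank_add_le_aux {F : Type*} [Field F] {α : Type*} [Fintype α] [DecidableEq α]
    (A B : Matrix α α F) : (A + B).rank ≤ A.rank + B.rank := by
  unfold Matrix.rank
  rw [Matrix.mulVecLin_add]
  refine (Submodule.finrank_mono (LinearMap.range_add_le _ _)).trans ?_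
  exact Submodule.finrank_add_le_finrank_add_finrank _ _

lemma rig_mul {F : Type*} [Field F] {α : Type*} [Fintype α] [DecidableEq α]
    (A B : Matrix α α F) (r r' s t : ℕ) (hA : Rig A r s) (hB : Rig B r' t) :
    Rig (A * B) (r + r') (s * t) := by
  obtain ⟨Z, a1, a2, a3⟩ := hA
  obtain ⟨W, b1, b2, b3⟩ := hB
  refine ⟨Z * W, ?_, card_mul_le Z W s t a2 b2, fun j => ?_⟩
  · have e : A * B - Z * W = (A - Z) * B + Z * (B - W) := by
      rw [Matrix.sub_mul, Matrix.mul_sub]; abel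
    rw [e]
    refine (rank_add_le_aux _ _).trans (add_le_add ?_ ?_)
    · exact (Matrix.rank_mul_le_left _ _).trans a1
    · exact (Matrix.rank_mul_le_right _ _).trans b1
  · have := card_mul_le W.transpose Z.transpose t s b3 a3 j
    rw [← Matrix.transpose_mul, mul_comm t s] at this
    exact this

/-- The Kronecker product of a family. -/
def Kr {F : Type*} [Field F] {d k : ℕ} (M : Fin k → Matrix (Fin d) (Fin d) F) :
    Matrix (Fin k → Fin d) (Fin k → Fin d) F :=
  Matrix.of fun x y => ∏ i, M i (x i) (y i)

lemma Kr_mul {F : Type*} [Field F] {d k : ℕ} (A B : Fin k → Matrix (Fin d) (Fin d) F) :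
    Kr (fun i => A i * B i) = Kr A * Kr B := by
  ext x y
  simp only [Kr, Matrix.of_apply, Matrix.mul_apply, Finset.prod_univ_sum, ← Finset.prod_mul_distrib,
    Fintype.piFinset_univ]

lemma rig_Emat {F : Type*} [Field F] {d k : ℕ} (hd : 2 ≤ d) (r t : ℕ)
    (ht : ∀ X : Fin k → Fin d → F, rcRigid (GmatK d k X) r ≤ t)
    (p : Fin k → Fin d) (x : Fin k → Fin d → F) :
    Rig (Kr fun i => Emat (p i) (x i)) r t := by
  let last : Fin d := ⟨d - 1, by omega⟩
  let s : Fin k → Equiv.Perm (Fin d) := fun i => Equiv.swap (p i) last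
  let S : (Fin k → Fin d) ≃ (Fin k → Fin d) := Equiv.piCongrRight s
  obtain ⟨Z, h1, h2, h3⟩ := rig_of_le _ _ _ (ht fun i => x i ∘ s i)
  have e : (Kr fun i => Emat (p i) (x i)) = (GmatK d k fun i => x i ∘ s i).submatrix S S := by
    ext a b
    simp only [Kr, GmatK, Matrix.of_apply, Matrix.submatrix_apply]
    refine Finset.prod_congr rfl fun i _ => ?_
    have hS : ∀ a, S a i = s i (a i) := fun a => rfl
    have hl : ((s i (b i) : Fin d) : ℕ) = d - 1 ↔ b i = p i := by
      have : ((s i (b i) : Fin d) : ℕ) = d - 1 ↔ s i (b i) = last := by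
        rw [Fin.ext_iff]
      rw [this, ← Equiv.eq_symm_apply]
      simp [s]
    simp only [Emat, Gmat, Matrix.of_apply, hS, hl, Function.comp, (s i).injective.eq_iff]
    simp [s]
  refine ⟨Z.submatrix S S, ?_, fun i => ?_, fun j => ?_⟩
  · rw [e]
    exact (Matrix.rank_submatrix ((GmatK d k fun i => x i ∘ s i) - Z) S S).le.trans h1
  · refine le_trans (le_of_eq (Nat.card_congr ?_)) (h2 (S i))
    exact S.subtypeEquiv fun a => Iff.rfl
  · refine le_trans (le_of_eq (Nat.card_congr ?_)) (h3 (S j))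
    exact S.subtypeEquiv fun a => Iff.rfl

lemma rig_fac {F : Type*} [Field F] {d k : ℕ} (hd : 2 ≤ d) (r t : ℕ)
    (ht : ∀ X : Fin k → Fin d → F, rcRigid (GmatK d k X) r ≤ t) (n : ℕ) :
    ∀ A : Fin k → Matrix (Fin d) (Fin d) F, (∀ i, Fac n (A i)) → Rig (Kr A) (n * r) (t ^ n) := by
  induction n with
  | zero =>
    intro A hA
    choose σ hσ using hA
    have hz : ∀ x y, Kr A x y ≠ 0 → ∀ i, σ i (x i) = y i := by
      intro x y h i
      have := Finset.prod_ne_zero_iff.1 (show (∏ i, A i (x i) (y i)) ≠ 0 from h) i (Finset.mem_univ _)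
      rw [hσ i] at this
      by_contra hc
      simp [hc] at this
    refine ⟨Kr A, by simp, fun x => ?_, fun y => ?_⟩
    · rw [pow_zero, Finite.card_le_one_iff_subsingleton]
      refine ⟨fun a b => Subtype.ext (funext fun i => ?_)⟩
      rw [← hz _ _ a.2 i, ← hz _ _ b.2 i]
    · rw [pow_zero, Finite.card_le_one_iff_subsingleton]
      refine ⟨fun a b => Subtype.ext (funext fun i => ?_)⟩
      exact (σ i).injective ((hz _ _ a.2 i).trans (hz _ _ b.2 i).symm)
  | succ n ih =>
    intro A hA
    choose p x B hB hAB using hA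
    have e : A = fun i => Emat (p i) (x i) * B i := funext hAB
    rw [e, Kr_mul]
    have := rig_mul _ _ _ _ _ _ (rig_Emat hd r t ht p x) (ih B hB)
    rwa [show r + n * r = (n + 1) * r by ring, show t * t ^ n = t ^ (n + 1) by ring] at this

/-- If `t` bounds `R^{rc}(G_{d,k}(X), r)` for every `X ∈ F^{d×k}`, then
`R^{rc}(⊗_i M_i, (2d−2)r) ≤ t^{2d−2}`. -/
theorem rcRigid_kron_reduction {F : Type*} [Field F] (d k : ℕ) (hd : 2 ≤ d)
    (r : ℕ) (hr : r ≤ d ^ k) (M : Fin k → Matrix (Fin d) (Fin d) F)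
    (t : ℕ) (ht : ∀ X : Fin k → Fin d → F, rcRigid (GmatK d k X) r ≤ t) :
    rcRigid (Matrix.of fun x y : Fin k → Fin d => ∏ i, M i (x i) (y i))
      ((2 * d - 2) * r) ≤ t ^ (2 * d - 2) := by
  refine Nat.sInf_le ?_
  exact rig_fac hd r t ht (2 * d - 2) M fun i =>
    fac_all (by omega) _ ∅ 1 (M i) (by simp; omega) (by simp)
end

section
/- Let 2 ≤ b ≤ d_1 ≤ … ≤ d_k ≤ b² be integers, 0 < ε < 1, and γ > 0 satisfy γ·log b ≥ 2·log(3/ε) and b ≥ 3/ε. Suppose each d_i×d_i matrix M_i over F satisfies R^{rc}(M_i, d_i^{1−γ}) ≤ d_i^ε. Then M = ⊗_{i∈[k]} M_i with n = ∏ d_i satisfies R^{rc}(M, n^{1−εγ/4}) ≤ n^{4ε}. -/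
namespace KronRigid

theorem fac {F m n : Type*} [Field F] [Fintype m] [Fintype n] [DecidableEq n] (A : Matrix m n F) :
    ∃ (U : Matrix m (Fin A.rank) F) (V : Matrix (Fin A.rank) n F), A = U * V := by
  let W := LinearMap.range A.mulVecLin
  let bs : Module.Basis (Fin A.rank) F W := Module.finBasis F W
  refine ⟨Matrix.of fun i j => (bs j : m → F) i,
    Matrix.of fun j c => bs.repr ⟨A.mulVecLin (Pi.single c 1), ⟨_, rfl⟩⟩ j, ?_⟩
  ext i c
  have h := congrArg (fun w : W => (w : m → F) i)
    (bs.sum_repr ⟨A.mulVecLin (Pi.single c 1), ⟨_, rfl⟩⟩)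
  simp only [AddSubmonoidClass.coe_finset_sum, Finset.sum_apply, Submodule.coe_smul,
    Pi.smul_apply, smul_eq_mul] at h
  rw [Matrix.mul_apply]
  simp only [Matrix.of_apply]
  calc A i c = A.mulVecLin (Pi.single c 1) i := by simp
    _ = _ := by rw [← h]; exact Finset.sum_congr rfl fun j _ => mul_comm _ _

theorem rank_add_le {F m n : Type*} [Field F] [Fintype m] [Fintype n] (A B : Matrix m n F) :
    (A + B).rank ≤ A.rank + B.rank := by
  unfold Matrix.rank
  rw [Matrix.mulVecLin_add]
  refine le_trans (Submodule.finrank_mono (t := A.mulVecLin.range ⊔ B.mulVecLin.range) ?_)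
    (Submodule.finrank_add_le_finrank_add_finrank _ _)
  exact LinearMap.range_add_le _ _

theorem rank_sum_le {F m n ι : Type*} [Field F] [Fintype m] [Fintype n] (s : Finset ι)
    (A : ι → Matrix m n F) : (∑ i ∈ s, A i).rank ≤ ∑ i ∈ s, (A i).rank := by
  classical
  induction s using Finset.induction_on with
  | empty => simp
  | insert a s ha ih =>
    rw [Finset.sum_insert ha, Finset.sum_insert ha]
    exact (rank_add_le _ _).trans (by gcongr)

theorem rank_kron_le {F : Type*} [Field F] {k : ℕ} {d : Fin k → ℕ}
    (B : ∀ i, Matrix (Fin (d i)) (Fin (d i)) F) :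
    (Matrix.of fun x y : ∀ i, Fin (d i) => ∏ i, B i (x i) (y i)).rank ≤ ∏ i, (B i).rank := by
  choose U V h using fun i => fac (B i)
  have : (Matrix.of fun x y : ∀ i, Fin (d i) => ∏ i, B i (x i) (y i))
      = (Matrix.of fun (x : ∀ i, Fin (d i)) (j : ∀ i, Fin (B i).rank) => ∏ i, U i (x i) (j i)) *
        (Matrix.of fun (j : ∀ i, Fin (B i).rank) (y : ∀ i, Fin (d i)) => ∏ i, V i (j i) (y i)) := by
    ext x y
    simp only [Matrix.of_apply, Matrix.mul_apply, ← Finset.prod_mul_distrib]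
    rw [← Fintype.prod_sum (fun i (j : Fin (B i).rank) => U i (x i) j * V i j (y i))]
    refine Finset.prod_congr rfl fun i _ => ?_
    rw [← Matrix.mul_apply, ← h i]
  rw [this]
  refine (Matrix.rank_mul_le_left _ _).trans ((Matrix.rank_le_card_width _).trans ?_)
  simp

theorem sum_eps (k : ℕ) (ε : ℝ) (h0 : 0 < ε) (P : Finset (Finset (Fin k))) :
    ∑ S ∈ P, ε ^ S.card ≤ (Real.exp 1) ^ (ε * k) := by
  have h1 := Fintype.sum_pow_mul_eq_add_pow (Fin k) ε (1 : ℝ)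
  simp only [one_pow, mul_one, Fintype.card_fin] at h1
  calc ∑ S ∈ P, ε ^ S.card ≤ ∑ S : Finset (Fin k), ε ^ S.card :=
        Finset.sum_le_univ_sum_of_nonneg fun S => by positivity
    _ = (ε + 1) ^ k := h1
    _ ≤ (Real.exp ε) ^ k := by gcongr; exact Real.add_one_le_exp ε
    _ = _ := by rw [← Real.exp_nat_mul, ← Real.exp_mul]; ring_nf

theorem sum_large (k : ℕ) (ε q : ℝ) (h0 : 0 < ε) (h1 : ε < 1) (hq : 0 < q) (hq1 : q ≤ ε / 3)
    (P : Finset (Finset (Fin k))) (hP : ∀ S ∈ P, ε * k < S.card) :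
    ∑ S ∈ P, (q ^ 2) ^ S.card ≤ q ^ (ε * k) := by
  have hx : q ^ 2 / ε ≤ 1 := by rw [div_le_one h0]; nlinarith
  have hx0 : 0 < q ^ 2 / ε := by positivity
  calc ∑ S ∈ P, (q ^ 2) ^ S.card ≤ ∑ S ∈ P, ε ^ S.card * (q ^ 2 / ε) ^ (ε * k) := by
        refine Finset.sum_le_sum fun S hS => ?_
        have : (q ^ 2) ^ S.card = ε ^ S.card * (q ^ 2 / ε) ^ (S.card : ℝ) := by
          rw [Real.rpow_natCast, ← mul_pow]; congr 1; field_simp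
        rw [this]
        gcongr ?_ * ?_
        exact Real.rpow_le_rpow_of_exponent_ge hx0 hx (hP S hS).le
    _ ≤ (Real.exp 1) ^ (ε * k) * (q ^ 2 / ε) ^ (ε * k) := by
        rw [← Finset.sum_mul]
        gcongr
        exact sum_eps k ε h0 P
    _ = (Real.exp 1 * (q ^ 2 / ε)) ^ (ε * k) :=
        (Real.mul_rpow (Real.exp_pos _).le hx0.le).symm
    _ ≤ q ^ (ε * k) := by
        refine Real.rpow_le_rpow (by positivity) ?_ (by positivity)
        have he := Real.exp_one_lt_three
        calc Real.exp 1 * (q ^ 2 / ε) ≤ 3 * (q ^ 2 / ε) := by gcongr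
          _ = q * (q * 3 / ε) := by ring
          _ ≤ q * 1 := by gcongr; rw [div_le_one h0]; linarith
          _ = q := mul_one q

theorem card_small (k : ℕ) (ε b : ℝ) (h0 : 0 < ε) (h1 : ε < 1) (hb : 3 / ε ≤ b)
    (P : Finset (Finset (Fin k))) (hP : ∀ S ∈ P, (S.card : ℝ) ≤ ε * k) :
    (P.card : ℝ) ≤ b ^ (ε * k) := by
  calc (P.card : ℝ) = ∑ S ∈ P, (1 : ℝ) := by simp
    _ ≤ ∑ S ∈ P, ε ^ S.card * (1 / ε) ^ (ε * k) := by
        refine Finset.sum_le_sum fun S hS => ?_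
        have : (1 : ℝ) = ε ^ S.card * (1 / ε) ^ (S.card : ℝ) := by
          rw [Real.rpow_natCast, ← mul_pow, mul_one_div_cancel h0.ne', one_pow]
        conv_lhs => rw [this]
        gcongr ?_ * ?_
        exact Real.rpow_le_rpow_of_exponent_le (by rw [le_div_iff₀ h0]; linarith) (hP S hS)
    _ ≤ (Real.exp 1) ^ (ε * k) * (1 / ε) ^ (ε * k) := by
        rw [← Finset.sum_mul]
        gcongr
        exact sum_eps k ε h0 P
    _ = (Real.exp 1 * (1 / ε)) ^ (ε * k) :=
        (Real.mul_rpow (Real.exp_pos _).le (by positivity)).symm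
    _ ≤ b ^ (ε * k) := by
        refine Real.rpow_le_rpow (by positivity) ?_ (by positivity)
        have he := Real.exp_one_lt_three
        calc Real.exp 1 * (1 / ε) ≤ 3 * (1 / ε) := by gcongr
          _ = 3 / ε := by ring
          _ ≤ b := hb

/-- the mixed product -/
def T {F : Type*} [Field F] {k : ℕ} {d : Fin k → ℕ}
    (A Z : ∀ i, Matrix (Fin (d i)) (Fin (d i)) F) (S : Finset (Fin k)) :
    Matrix (∀ i, Fin (d i)) (∀ i, Fin (d i)) F :=
  Matrix.of fun x y => ∏ i, (if i ∈ S then A i else Z i) (x i) (y i)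

theorem expand {F : Type*} [Field F] {k : ℕ} {d : Fin k → ℕ}
    (A Z : ∀ i, Matrix (Fin (d i)) (Fin (d i)) F) :
    (Matrix.of fun x y : ∀ i, Fin (d i) => ∏ i, (A i + Z i) (x i) (y i))
      = ∑ S : Finset (Fin k), T A Z S := by
  ext x y
  simp only [Matrix.of_apply, Matrix.add_apply, Matrix.sum_apply, T]
  rw [Finset.prod_add, Finset.powerset_univ]
  refine Finset.sum_congr rfl fun S _ => ?_
  have : ∀ i, (if i ∈ S then A i else Z i) (x i) (y i)
      = if i ∈ S then A i (x i) (y i) else Z i (x i) (y i) := by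
    intro i; split_ifs <;> rfl
  simp only [this]
  rw [Finset.prod_ite]
  congr 1
  · congr 1; ext; simp
  · congr 1; ext; simp

theorem rows {F : Type*} [Field F] {b k : ℕ} (hb : 2 ≤ b) {d : Fin k → ℕ}
    (hlb : ∀ i, b ≤ d i) (hub : ∀ i, d i ≤ b ^ 2)
    (ε : ℝ) (hε0 : 0 < ε) (hε1 : ε < 1) (hbε : 3 / ε ≤ (b : ℝ))
    (A Z : ∀ i, Matrix (Fin (d i)) (Fin (d i)) F)
    (hZ : ∀ i r, (Nat.card {c // Z i r c ≠ 0} : ℝ) ≤ (d i : ℝ) ^ ε)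
    (P : Finset (Finset (Fin k))) (hP : ∀ S ∈ P, (S.card : ℝ) ≤ ε * k)
    (x : ∀ i, Fin (d i)) :
    (Nat.card {y // (∑ S ∈ P, T A Z S) x y ≠ 0} : ℝ) ≤ ((∏ i, d i : ℕ) : ℝ) ^ (4 * ε) := by
  classical
  have hb1 : (1 : ℝ) ≤ b := by exact_mod_cast (by omega : 1 ≤ b)
  have hd1 : ∀ i, (1 : ℝ) ≤ d i := fun i => hb1.trans (by exact_mod_cast hlb i)
  have hn : (b : ℝ) ^ k ≤ ((∏ i, d i : ℕ) : ℝ) := by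
    push_cast
    calc (b : ℝ) ^ k = ∏ _i : Fin k, (b : ℝ) := by simp
      _ ≤ _ := Finset.prod_le_prod (fun _ _ => by positivity) fun i _ => by exact_mod_cast hlb i
  set n : ℝ := ((∏ i, d i : ℕ) : ℝ) with hndef
  have hn1 : 1 ≤ n := (one_le_pow₀ hb1).trans hn
  have hbn : (b : ℝ) ^ (ε * k) ≤ n ^ ε := by
    rw [mul_comm, Real.rpow_mul (by positivity), Real.rpow_natCast]
    exact Real.rpow_le_rpow (by positivity) hn hε0.le
  have hone : ∀ S ∈ P,
      ((Finset.univ.filter fun y => T A Z S x y ≠ 0).card : ℝ) ≤ n ^ (3 * ε) := by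
    intro S hS
    have hsub : (Finset.univ.filter fun y => T A Z S x y ≠ 0) ⊆ Fintype.piFinset fun i =>
        Finset.univ.filter fun c => (if i ∈ S then A i else Z i) (x i) c ≠ 0 := by
      intro y hy
      simp only [T, Matrix.of_apply, Finset.mem_filter, Finset.mem_univ, true_and,
        Finset.prod_ne_zero_iff] at hy
      simp only [Fintype.mem_piFinset, Finset.mem_filter, Finset.mem_univ, true_and]
      exact fun i => hy i trivial
    have h1 := Finset.card_le_card hsub
    rw [Fintype.card_piFinset] at h1
    have h2 : (∏ i, ((Finset.univ.filter fun c =>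
        (if i ∈ S then A i else Z i) (x i) c ≠ 0).card : ℝ)) ≤
        ∏ i, ((d i : ℝ) ^ ε * if i ∈ S then (b : ℝ) ^ 2 else 1) := by
      refine Finset.prod_le_prod (fun _ _ => by positivity) fun i _ => ?_
      have h1e : 1 ≤ (d i : ℝ) ^ ε := Real.one_le_rpow (hd1 i) hε0.le
      by_cases hi : i ∈ S
      · simp only [hi, if_true]
        have h3 : ((Finset.univ.filter fun c => A i (x i) c ≠ 0).card : ℝ) ≤ d i := by
          exact_mod_cast (Finset.card_le_univ _).trans (by simp)
        have h4 : (d i : ℝ) ≤ (b : ℝ) ^ 2 := by exact_mod_cast hub i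
        nlinarith [sq_nonneg (b : ℝ)]
      · simp only [hi, if_false, mul_one]
        have := hZ i (x i)
        rwa [Nat.card_eq_fintype_card, Fintype.card_subtype] at this
    have h3 : ∏ i, ((d i : ℝ) ^ ε * if i ∈ S then (b : ℝ) ^ 2 else 1)
        = n ^ ε * ((b : ℝ) ^ 2) ^ S.card := by
      rw [Finset.prod_mul_distrib, Finset.prod_ite_mem, Finset.univ_inter, Finset.prod_const,
        Real.finset_prod_rpow _ _ (fun i _ => by positivity), hndef]
      push_cast
      rfl
    have h4 : ((b : ℝ) ^ 2) ^ S.card ≤ n ^ ε * n ^ ε := by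
      rw [← pow_mul, mul_comm, pow_mul, sq]
      have : (b : ℝ) ^ S.card ≤ n ^ ε := by
        rw [← Real.rpow_natCast]
        exact (Real.rpow_le_rpow_of_exponent_le hb1 (hP S hS)).trans hbn
      gcongr
    calc ((Finset.univ.filter fun y => T A Z S x y ≠ 0).card : ℝ)
        ≤ ∏ i, ((Finset.univ.filter fun c =>
        (if i ∈ S then A i else Z i) (x i) c ≠ 0).card : ℝ) := by exact_mod_cast h1
      _ ≤ n ^ ε * ((b : ℝ) ^ 2) ^ S.card := h2.trans h3.le
      _ ≤ n ^ ε * (n ^ ε * n ^ ε) := by gcongr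
      _ = n ^ (3 * ε) := by
        rw [← Real.rpow_add (by positivity), ← Real.rpow_add (by positivity)]; ring_nf
  rw [Nat.card_eq_fintype_card, Fintype.card_subtype]
  have hU : (Finset.univ.filter fun y => (∑ S ∈ P, T A Z S) x y ≠ 0) ⊆
      P.biUnion fun S => Finset.univ.filter fun y => T A Z S x y ≠ 0 := by
    intro y hy
    simp only [Matrix.sum_apply, Finset.mem_filter, Finset.mem_univ, true_and] at hy
    obtain ⟨S, hS, h⟩ := Finset.exists_ne_zero_of_sum_ne_zero hy
    simp only [Finset.mem_biUnion, Finset.mem_filter, Finset.mem_univ, true_and]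
    exact ⟨S, hS, h⟩
  have hU2 := (Finset.card_le_card hU).trans Finset.card_biUnion_le
  calc ((Finset.univ.filter fun y => (∑ S ∈ P, T A Z S) x y ≠ 0).card : ℝ)
      ≤ ∑ S ∈ P, ((Finset.univ.filter fun y => T A Z S x y ≠ 0).card : ℝ) := by
        exact_mod_cast hU2
    _ ≤ ∑ S ∈ P, n ^ (3 * ε) := Finset.sum_le_sum hone
    _ = P.card * n ^ (3 * ε) := by simp
    _ ≤ n ^ ε * n ^ (3 * ε) := by
        gcongr
        exact (card_small k ε b hε0 hε1 hbε P hP).trans hbn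
    _ = n ^ (4 * ε) := by rw [← Real.rpow_add (by positivity)]; ring_nf

theorem rank_large {F : Type*} [Field F] {b k : ℕ} (hb : 2 ≤ b) {d : Fin k → ℕ}
    (hlb : ∀ i, b ≤ d i) (hub : ∀ i, d i ≤ b ^ 2)
    (ε γ : ℝ) (hε0 : 0 < ε) (hε1 : ε < 1) (hγ : 0 < γ)
    (hγb : 2 * Real.log (3 / ε) ≤ γ * Real.log b)
    (A Z : ∀ i, Matrix (Fin (d i)) (Fin (d i)) F)
    (hA : ∀ i, ((A i).rank : ℝ) ≤ (d i : ℝ) ^ ((1 : ℝ) - γ))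
    (P : Finset (Finset (Fin k))) (hP : ∀ S ∈ P, ε * k < S.card) :
    ((∑ S ∈ P, T A Z S).rank : ℝ) ≤ ((∏ i, d i : ℕ) : ℝ) ^ ((1 : ℝ) - ε * γ / 4) := by
  classical
  have hb0 : (0 : ℝ) < b := by exact_mod_cast (by omega : 0 < b)
  have hd0 : ∀ i, (0 : ℝ) < d i := fun i => hb0.trans_le (by exact_mod_cast hlb i)
  have hn : ((∏ i, d i : ℕ) : ℝ) ≤ ((b : ℝ) ^ 2) ^ k := by
    push_cast
    calc ∏ i, (d i : ℝ) ≤ ∏ _i : Fin k, ((b : ℝ) ^ 2) :=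
          Finset.prod_le_prod (fun _ _ => by positivity) fun i _ => by exact_mod_cast hub i
      _ = _ := by simp
  have hn0 : 0 < ((∏ i, d i : ℕ) : ℝ) := by
    push_cast; exact Finset.prod_pos fun i _ => hd0 i
  set n : ℝ := ((∏ i, d i : ℕ) : ℝ) with hndef
  set q : ℝ := (b : ℝ) ^ (-(γ / 2)) with hq
  have hq0 : 0 < q := Real.rpow_pos_of_pos hb0 _
  have hq1 : q ≤ ε / 3 := by
    rw [← Real.log_le_log_iff hq0 (by positivity), hq, Real.log_rpow hb0]
    have : Real.log (3 / ε) = - Real.log (ε / 3) := by rw [← Real.log_inv, inv_div]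
    linarith
  have hq2 : q ^ 2 = (b : ℝ) ^ (-γ) := by
    rw [hq, ← Real.rpow_natCast, ← Real.rpow_mul hb0.le]; push_cast; ring_nf
  have hone : ∀ S, ((T A Z S).rank : ℝ) ≤ n * (q ^ 2) ^ S.card := by
    intro S
    have h1 : ((T A Z S).rank : ℝ) ≤ ∏ i, (((if i ∈ S then A i else Z i)).rank : ℝ) := by
      exact_mod_cast rank_kron_le (fun i => if i ∈ S then A i else Z i)
    have h2 : ∏ i, (((if i ∈ S then A i else Z i)).rank : ℝ) ≤
        ∏ i, ((d i : ℝ) * if i ∈ S then q ^ 2 else 1) := by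
      refine Finset.prod_le_prod (fun _ _ => by positivity) fun i _ => ?_
      by_cases hi : i ∈ S
      · simp only [hi, if_true]
        refine (hA i).trans ?_
        rw [sub_eq_add_neg, Real.rpow_add (hd0 i), Real.rpow_one, hq2]
        refine mul_le_mul_of_nonneg_left ?_ (hd0 i).le
        exact Real.rpow_le_rpow_of_nonpos hb0 (by exact_mod_cast hlb i) (by linarith)
      · simp only [hi, if_false, mul_one]
        exact_mod_cast (Z i).rank_le_width
    refine h1.trans (h2.trans (le_of_eq ?_))
    rw [Finset.prod_mul_distrib, Finset.prod_ite_mem, Finset.univ_inter, Finset.prod_const, hndef]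
    push_cast
    rfl
  calc ((∑ S ∈ P, T A Z S).rank : ℝ) ≤ ∑ S ∈ P, ((T A Z S).rank : ℝ) := by
        exact_mod_cast rank_sum_le P (T A Z)
    _ ≤ ∑ S ∈ P, n * (q ^ 2) ^ S.card := Finset.sum_le_sum fun S _ => hone S
    _ = n * ∑ S ∈ P, (q ^ 2) ^ S.card := by rw [Finset.mul_sum]
    _ ≤ n * q ^ (ε * k) := by
        gcongr
        exact sum_large k ε q hε0 hε1 hq0 hq1 P hP
    _ = n * (((b : ℝ) ^ 2) ^ k) ^ (-(ε * γ / 4)) := by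
        rw [hq, ← Real.rpow_mul hb0.le, ← pow_mul, ← Real.rpow_natCast, ← Real.rpow_mul hb0.le]
        push_cast; ring_nf
    _ ≤ n * n ^ (-(ε * γ / 4)) := by
        refine mul_le_mul_of_nonneg_left ?_ hn0.le
        exact Real.rpow_le_rpow_of_nonpos hn0 hn (by have := mul_pos hε0 hγ; linarith)
    _ = n ^ ((1 : ℝ) - ε * γ / 4) := by
        rw [sub_eq_add_neg, Real.rpow_add hn0, Real.rpow_one]

end KronRigid

/-- Let `2 ≤ b ≤ d₁ ≤ … ≤ d_k ≤ b²`, `0 < ε < 1`, `γ > 0` with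
`γ·log b ≥ 2·log(3/ε)` and `b ≥ 3/ε`. If each `d_i×d_i` matrix `M_i` satisfies
`R^{rc}(M_i, d_i^{1−γ}) ≤ d_i^ε`, then `M = ⊗_i M_i` with `n = ∏ d_i` satisfies
`R^{rc}(M, n^{1−εγ/4}) ≤ n^{4ε}`. -/
theorem rcRigid_kron_between_squares {F : Type*} [Field F] (b k : ℕ) (hb : 2 ≤ b)
    (d : Fin k → ℕ) (hmono : ∀ i j : Fin k, i ≤ j → d i ≤ d j)
    (hlb : ∀ i, b ≤ d i) (hub : ∀ i, d i ≤ b ^ 2)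
    (ε γ : ℝ) (hε0 : 0 < ε) (hε1 : ε < 1) (hγ : 0 < γ)
    (hγb : 2 * Real.log (3 / ε) ≤ γ * Real.log b)
    (hbε : 3 / ε ≤ (b : ℝ))
    (M : ∀ i, Matrix (Fin (d i)) (Fin (d i)) F)
    (hM : ∀ i, ∃ Z : Matrix (Fin (d i)) (Fin (d i)) F,
      ((M i - Z).rank : ℝ) ≤ (d i : ℝ) ^ ((1 : ℝ) - γ) ∧
      (∀ r, (Nat.card {c // Z r c ≠ 0} : ℝ) ≤ (d i : ℝ) ^ ε) ∧
      (∀ c, (Nat.card {r // Z r c ≠ 0} : ℝ) ≤ (d i : ℝ) ^ ε)) :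
    ∃ Z : Matrix (∀ i, Fin (d i)) (∀ i, Fin (d i)) F,
      (((Matrix.of fun x y : ∀ i, Fin (d i) => ∏ i, M i (x i) (y i)) - Z).rank : ℝ)
          ≤ ((∏ i, d i : ℕ) : ℝ) ^ ((1 : ℝ) - ε * γ / 4) ∧
      (∀ x, (Nat.card {y // Z x y ≠ 0} : ℝ) ≤ ((∏ i, d i : ℕ) : ℝ) ^ (4 * ε)) ∧
      (∀ y, (Nat.card {x // Z x y ≠ 0} : ℝ) ≤ ((∏ i, d i : ℕ) : ℝ) ^ (4 * ε)) := by
  classical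
  choose Z hA hr hc using hM
  have hM' : ∀ i, M i = (M i - Z i) + Z i := fun i => by simp
  set A := fun i => M i - Z i with hAdef
  let P : Finset (Finset (Fin k)) := Finset.univ.filter fun S => (S.card : ℝ) ≤ ε * k
  let Q : Finset (Finset (Fin k)) := Finset.univ.filter fun S => ¬ (S.card : ℝ) ≤ ε * k
  have hP : ∀ S ∈ P, (S.card : ℝ) ≤ ε * k := fun S hS => (Finset.mem_filter.1 hS).2
  have hQ : ∀ S ∈ Q, ε * k < S.card := fun S hS => not_le.1 (Finset.mem_filter.1 hS).2
  refine ⟨∑ S ∈ P, KronRigid.T A Z S, ?_, ?_, ?_⟩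
  · have h1 : (Matrix.of fun x y : ∀ i, Fin (d i) => ∏ i, M i (x i) (y i))
        = ∑ S : Finset (Fin k), KronRigid.T A Z S := by
      rw [← KronRigid.expand]
      simp [A]
    have h2 : (∑ S : Finset (Fin k), KronRigid.T A Z S) - ∑ S ∈ P, KronRigid.T A Z S
        = ∑ S ∈ Q, KronRigid.T A Z S := by
      rw [sub_eq_iff_eq_add, add_comm]
      exact (Finset.sum_filter_add_sum_filter_not _ _ _).symm
    rw [h1, h2]
    exact KronRigid.rank_large hb hlb hub ε γ hε0 hε1 hγ hγb A Z hA Q hQ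
  · exact KronRigid.rows hb hlb hub ε hε0 hε1 hbε A Z hr P hP
  · intro y
    have h := KronRigid.rows hb hlb hub ε hε0 hε1 hbε (fun i => (A i).transpose)
      (fun i => (Z i).transpose) hc P hP y
    have hT : ∀ S x, KronRigid.T (fun i => (A i).transpose) (fun i => (Z i).transpose) S y x
        = KronRigid.T A Z S x y := by
      intro S x
      simp only [KronRigid.T, Matrix.of_apply]
      refine Finset.prod_congr rfl fun i _ => ?_
      split_ifs <;> rfl
    simpa only [Matrix.sum_apply, hT] using h
end
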